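/- For every real κ ≥ 1, the series ∑_{k=0}^{∞} [ (1 + k/(√κ + 1)) (1 − 1/√κ)^k ]² converges and its sum is at most k*(κ) + √κ. -/

import Mathlib

/-- `k*(κ)`: the smallest positive integer `m` such that
`(1 + k/(√κ + 1))(1 − 1/√κ)^k ≤ (1 − 1/(2√κ))^k` for every integer `k ≥ m`. -/
noncomputable def kstar (κ : ℝ) : ℕ :=
  sInf {m : ℕ | 0 < m ∧ ∀ k : ℕ, m ≤ k →
    (1 + (k : ℝ) / (Real.sqrt κ + 1)) * (1 - 1 / Real.sqrt κ) ^ k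
      ≤ (1 - 1 / (2 * Real.sqrt κ)) ^ k}

theorem hasSum_sq_mul_geometric {r : ℝ} (hr₀ : 0 ≤ r) (hr : r < 1) :
    HasSum (fun k : ℕ => (k : ℝ) ^ 2 * r ^ k) (r * (1 + r) / (1 - r) ^ 3) := by
  have hn : ‖r‖ < 1 := by rwa [Real.norm_of_nonneg hr₀]
  have h := (((hasSum_choose_mul_geometric_of_norm_lt_one 2 hn).mul_left 2).sub
    ((hasSum_coe_mul_geometric_of_norm_lt_one hn).mul_left 3)).sub
    ((hasSum_geometric_of_lt_one hr₀ hr).mul_left 2)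
  have hne : 1 - r ≠ 0 := by linarith
  have hsum : 2 * (1 / (1 - r) ^ (2 + 1)) - 3 * (r / (1 - r) ^ 2) - 2 * (1 - r)⁻¹
      = r * (1 + r) / (1 - r) ^ 3 := by
    field_simp
    ring
  rw [hsum] at h
  have hfun : (fun k : ℕ => (k : ℝ) ^ 2 * r ^ k) = fun k : ℕ =>
      2 * (((k + 2).choose 2 : ℕ) * r ^ k) - 3 * (k * r ^ k) - 2 * r ^ k := by
    funext k
    rw [Nat.cast_choose_two]
    push_cast
    ring
  rwa [hfun]

theorem hasSum_sq_one_add_mul_mul_pow (c : ℝ) {q : ℝ} (hq : |q| < 1) :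
    HasSum (fun k : ℕ => ((1 + k * c) * q ^ k) ^ 2)
      (1 / (1 - q ^ 2) + 2 * c * (q ^ 2 / (1 - q ^ 2) ^ 2)
        + c ^ 2 * (q ^ 2 * (1 + q ^ 2) / (1 - q ^ 2) ^ 3)) := by
  have hr : q ^ 2 < 1 := (sq_lt_one_iff_abs_lt_one q).2 hq
  have hr₀ : 0 ≤ q ^ 2 := sq_nonneg q
  have hn : ‖q ^ 2‖ < 1 := by rwa [Real.norm_of_nonneg hr₀]
  have h := ((hasSum_geometric_of_lt_one hr₀ hr).add
    ((hasSum_coe_mul_geometric_of_norm_lt_one hn).mul_left (2 * c))).add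
    ((hasSum_sq_mul_geometric hr₀ hr).mul_left (c ^ 2))
  convert h using 1
  · funext k
    ring
  · rw [one_div]

theorem one_sub_inv_eq_mul {s : ℝ} (hs : 1 ≤ s) :
    1 - 1 / s = (1 - 1 / (2 * s)) * (1 - 1 / (2 * s - 1)) := by
  have h₁ : s ≠ 0 := by linarith
  have h₂ : s * 2 - 1 ≠ 0 := by linarith
  field_simp
  ring

theorem exists_forall_ge_one_add_mul_pow_le {s : ℝ} (hs : 1 ≤ s) :
    ∃ m : ℕ, 0 < m ∧ ∀ k : ℕ, m ≤ k →
      (1 + (k : ℝ) / (s + 1)) * (1 - 1 / s) ^ k ≤ (1 - 1 / (2 * s)) ^ k := by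
  have hpos : 0 < 2 * s - 1 := by linarith
  set p := 1 - 1 / (2 * s - 1) with hp
  have hp₀ : 0 ≤ p := by
    rw [hp, sub_nonneg, div_le_one hpos]
    linarith
  have hp₁ : p < 1 := by
    have : 0 < 1 / (2 * s - 1) := by positivity
    linarith
  have hlim : Filter.Tendsto (fun k : ℕ => p ^ k + (k * p ^ k) / (s + 1)) Filter.atTop
      (nhds (0 + 0 / (s + 1))) :=
    (tendsto_pow_atTop_nhds_zero_of_lt_one hp₀ hp₁).add
      ((tendsto_self_mul_const_pow_of_lt_one hp₀ hp₁).div_const _)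
  obtain ⟨m, hm⟩ := Filter.eventually_atTop.1
    (hlim.eventually_le_const (u := 1) (by norm_num))
  refine ⟨m + 1, m.succ_pos, fun k hk => ?_⟩
  have hb : 0 ≤ 1 - 1 / (2 * s) := by
    rw [sub_nonneg, div_le_one (by linarith)]
    linarith
  rw [one_sub_inv_eq_mul hs, mul_pow]
  calc (1 + (k : ℝ) / (s + 1)) * ((1 - 1 / (2 * s)) ^ k * p ^ k)
      = (1 - 1 / (2 * s)) ^ k * (p ^ k + (k * p ^ k) / (s + 1)) := by ring
    _ ≤ (1 - 1 / (2 * s)) ^ k * 1 :=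
        mul_le_mul_of_nonneg_left (hm k (by lia)) (pow_nonneg hb k)
    _ = _ := mul_one _

theorem pow_lt_one_add_mul_pow {s : ℝ} (hs : 1 ≤ s) {k : ℕ} (hk : 0 < k)
    (hks : (k : ℝ) < s - 2) :
    (1 - 1 / (2 * s)) ^ k < (1 + (k : ℝ) / (s + 1)) * (1 - 1 / s) ^ k := by
  have hpos : 0 < 2 * s - 1 := by linarith
  have hs₁ : 0 < s + 1 := by linarith
  have hk₀ : (0 : ℝ) < k := by exact_mod_cast hk
  have hb : 0 < 1 - 1 / (2 * s) := by
    rw [sub_pos, div_lt_one (by linarith)]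
    linarith
  have hdiv : 1 / (2 * s - 1) ≤ 1 := by
    rw [div_le_one hpos]
    linarith
  have hbern : 1 - k / (2 * s - 1) ≤ (1 - 1 / (2 * s - 1)) ^ k := by
    have := one_add_mul_le_pow (a := -(1 / (2 * s - 1))) (by linarith) k
    calc 1 - k / (2 * s - 1) = 1 + k * -(1 / (2 * s - 1)) := by ring
      _ ≤ (1 + -(1 / (2 * s - 1))) ^ k := this
      _ = _ := by rw [← sub_eq_add_neg]
  have hprod : 1 < (1 + (k : ℝ) / (s + 1)) * (1 - k / (2 * s - 1)) := by
    have hne : s * 2 - 1 ≠ 0 := by linarith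
    have : (1 + (k : ℝ) / (s + 1)) * (1 - k / (2 * s - 1)) - 1
        = k * (s - 2 - k) / ((s + 1) * (2 * s - 1)) := by
      field_simp
      ring
    have : 0 < k * (s - 2 - k) / ((s + 1) * (2 * s - 1)) :=
      div_pos (mul_pos hk₀ (by linarith)) (by positivity)
    linarith
  rw [one_sub_inv_eq_mul hs, mul_pow]
  calc (1 - 1 / (2 * s)) ^ k = (1 - 1 / (2 * s)) ^ k * 1 := (mul_one _).symm
    _ < (1 - 1 / (2 * s)) ^ k * ((1 + (k : ℝ) / (s + 1)) * (1 - 1 / (2 * s - 1)) ^ k) :=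
        mul_lt_mul_of_pos_left (hprod.trans_le (by gcongr)) (pow_pos hb k)
    _ = _ := by ring

theorem sqrt_div_four_le_kstar {κ : ℝ} (hκ : 1 ≤ κ) : Real.sqrt κ / 4 ≤ kstar κ := by
  have hs : 1 ≤ Real.sqrt κ := Real.one_le_sqrt.2 hκ
  obtain ⟨hpos, hle⟩ := Nat.sInf_mem (exists_forall_ge_one_add_mul_pow_le hs)
  change 0 < kstar κ at hpos
  by_contra! hlt
  have h₁ : (1 : ℝ) ≤ kstar κ := by exact_mod_cast hpos
  exact (pow_lt_one_add_mul_pow hs hpos (by linarith)).not_ge (hle _ le_rfl)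

theorem sum_closed_form_le {s : ℝ} (hs : 1 ≤ s) :
    1 / (1 - (1 - 1 / s) ^ 2)
        + 2 * (1 / (s + 1)) * ((1 - 1 / s) ^ 2 / (1 - (1 - 1 / s) ^ 2) ^ 2)
        + (1 / (s + 1)) ^ 2 *
          ((1 - 1 / s) ^ 2 * (1 + (1 - 1 / s) ^ 2) / (1 - (1 - 1 / s) ^ 2) ^ 3)
      ≤ 5 / 4 * s := by
  have h₀ : 0 < s := by linarith
  have h₁ : 0 < s + 1 := by linarith
  have h₂ : 0 < 2 * s - 1 := by linarith
  have hr : 1 - (1 - 1 / s) ^ 2 = (2 * s - 1) / s ^ 2 := by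
    field_simp
    ring
  have hq : 1 - 1 / s = (s - 1) / s := by field_simp
  rw [hr, hq]
  have heq : 1 / ((2 * s - 1) / s ^ 2)
        + 2 * (1 / (s + 1)) * (((s - 1) / s) ^ 2 / ((2 * s - 1) / s ^ 2) ^ 2)
        + (1 / (s + 1)) ^ 2 *
          (((s - 1) / s) ^ 2 * (1 + ((s - 1) / s) ^ 2) / ((2 * s - 1) / s ^ 2) ^ 3)
      = s ^ 2 * ((s + 1) ^ 2 * (2 * s - 1) ^ 2 + 2 * (s - 1) ^ 2 * (s + 1) * (2 * s - 1)
          + (s - 1) ^ 2 * (2 * s ^ 2 - 2 * s + 1)) / ((s + 1) ^ 2 * (2 * s - 1) ^ 3) := by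
    field_simp
    ring
  rw [heq, div_le_iff₀ (by positivity)]
  obtain ⟨u, rfl⟩ : ∃ u, s = 1 + u := ⟨s - 1, by ring⟩
  have hu : 0 ≤ u := by linarith
  rw [← sub_nonneg]
  ring_nf
  positivity


/-- For every real `κ ≥ 1`, the series
`∑_{k=0}^∞ [(1 + k/(√κ + 1)) (1 − 1/√κ)^k]²` converges and its sum is at most `k*(κ) + √κ`. -/
theorem tsum_sq_le_kstar_add_sqrt (κ : ℝ) (hκ : 1 ≤ κ) :
    Summable (fun k : ℕ =>
      ((1 + (k : ℝ) / (Real.sqrt κ + 1)) * (1 - 1 / Real.sqrt κ) ^ k) ^ 2) ∧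
    ∑' k : ℕ, ((1 + (k : ℝ) / (Real.sqrt κ + 1)) * (1 - 1 / Real.sqrt κ) ^ k) ^ 2
      ≤ (kstar κ : ℝ) + Real.sqrt κ := by
  have hs : 1 ≤ Real.sqrt κ := Real.one_le_sqrt.2 hκ
  have hq : |1 - 1 / Real.sqrt κ| < 1 := by
    have h₁ : 1 / Real.sqrt κ ≤ 1 := (div_le_one (by linarith)).2 hs
    have h₂ : 0 < 1 / Real.sqrt κ := by positivity
    rw [abs_lt]
    constructor <;> linarith
  have h := hasSum_sq_one_add_mul_mul_pow (1 / (Real.sqrt κ + 1)) hq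
  simp only [mul_one_div] at h
  refine ⟨h.summable, ?_⟩
  rw [h.tsum_eq]
  have h₁ := sum_closed_form_le hs
  have h₂ := sqrt_div_four_le_kstar hκ
  simp only [mul_one_div] at h₁
  linarith
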